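/- For every integer N ≥ 1 and every ε ∈ (0,1], μᴺ({ω ∈ Xᴺ : S(t̄(ω)) ≥ ε}) ≤ (2/ε)·e^{−2Nε²}. -/

import Mathlib

open MeasureTheory

open scoped Classical in
/-- Empirical fraction of sample points lying in `O k`. -/
noncomputable def empFrac {X : Type*} (O : ℕ → Set X) {N : ℕ} (ω : Fin N → X) (k : ℕ) : ℝ :=
  ((Finset.univ.filter fun i => ω i ∈ O k).card : ℝ) / N

/-- The empirically estimated invariance horizon: the least `k` with `θ_k(ω) = θ_{k+1}(ω)`. -/
noncomputable def tbar {X : Type*} (O : ℕ → Set X) {N : ℕ} (ω : Fin N → X) : ℕ :=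
  sInf {k : ℕ | empFrac O ω k = empFrac O ω (k + 1)}

open scoped Classical in
lemma empFrac_eq_iff {X : Type*} {O : ℕ → Set X} {N : ℕ} (hN : 1 ≤ N) (ω : Fin N → X) (j k : ℕ) :
    empFrac O ω j = empFrac O ω k ↔
      (Finset.univ.filter fun i => ω i ∈ O j).card =
        (Finset.univ.filter fun i => ω i ∈ O k).card := by
  have h : (N : ℝ) ≠ 0 := by positivity
  simp only [empFrac, div_left_inj' h, Nat.cast_inj]

lemma empFrac_tbar_eq {X : Type*} {O : ℕ → Set X} (hO : ∀ k, O (k + 1) ⊆ O k) {N : ℕ}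
    (hN : 1 ≤ N) (ω : Fin N → X) :
    empFrac O ω (tbar O ω) = empFrac O ω (tbar O ω + 1) := by
  classical
  suffices h : {k : ℕ | empFrac O ω k = empFrac O ω (k + 1)}.Nonempty from Nat.sInf_mem h
  by_contra hne
  have hlt : ∀ k, (Finset.univ.filter fun i => ω i ∈ O (k + 1)).card <
      (Finset.univ.filter fun i => ω i ∈ O k).card := fun k => by
    refine lt_of_le_of_ne
      (Finset.card_le_card (Finset.monotone_filter_right _ fun i _ hi => hO k hi)) fun h => ?_
    exact hne ⟨k, (empFrac_eq_iff hN ω k (k + 1)).2 (by convert h.symm)⟩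
  have hle : ∀ k, (Finset.univ.filter fun i => ω i ∈ O k).card + k ≤
      (Finset.univ.filter fun i => ω i ∈ O 0).card := fun k => by
    induction k with
    | zero => simp
    | succ k ih => have := hlt k; omega
  have := hle ((Finset.univ.filter fun i => ω i ∈ O 0).card + 1)
  omega

lemma notMem_diff_of_empFrac_eq {X : Type*} {O : ℕ → Set X} {k : ℕ} (hO : O (k + 1) ⊆ O k)
    {N : ℕ} (hN : 1 ≤ N) {ω : Fin N → X} (h : empFrac O ω k = empFrac O ω (k + 1)) (i : Fin N) :
    ω i ∉ O k \ O (k + 1) := by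
  classical
  rintro ⟨hi, hi'⟩
  refine hi' ?_
  have hcard := (empFrac_eq_iff hN ω k (k + 1)).1 h
  have hsub : (Finset.univ.filter fun i => ω i ∈ O (k + 1)) ⊆
      Finset.univ.filter fun i => ω i ∈ O k :=
    Finset.monotone_filter_right _ fun i _ hi => hO hi
  have heq := Finset.eq_of_subset_of_card_le hsub (by convert hcard.le)
  have hmem : i ∈ Finset.univ.filter fun i => ω i ∈ O k := by simpa using hi
  rw [← heq] at hmem
  simpa using hmem

lemma one_sub_le_exp_neg_two_mul_sq {x : ℝ} (hx : 0 ≤ x) :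
    1 - x ≤ Real.exp (-2 * x ^ 2) := by
  have hderiv : ∀ y : ℝ, HasDerivAt (fun y : ℝ => (1 - y) * Real.exp (2 * y ^ 2))
      (-(1 - 2 * y) ^ 2 * Real.exp (2 * y ^ 2)) y := fun y => by
    have h := ((hasDerivAt_id y).const_sub 1).mul
      (((hasDerivAt_pow 2 y).const_mul 2).exp)
    refine h.congr_deriv ?_
    simp only [id]
    push_cast
    ring
  have hanti : Antitone fun y : ℝ => (1 - y) * Real.exp (2 * y ^ 2) :=
    antitone_of_hasDerivAt_nonpos hderiv fun y =>
      mul_nonpos_of_nonpos_of_nonneg (neg_nonpos.2 (sq_nonneg _)) (Real.exp_pos _).le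
  have h := hanti hx
  rw [neg_mul, Real.exp_neg, ← one_div, le_div_iff₀ (Real.exp_pos _)]
  simpa using h

lemma pairwise_disjoint_diff_succ {X : Type*} {O : ℕ → Set X} (hO : ∀ k, O (k + 1) ⊆ O k) :
    Pairwise (Function.onFun Disjoint fun k => O k \ O (k + 1)) := by
  have hanti : Antitone O := antitone_nat_of_succ_le hO
  refine (pairwise_disjoint_on _).2 fun j k hjk => Set.disjoint_left.2 fun x hx hx' => ?_
  exact hx.2 (hanti hjk hx'.1)

/-- For every `N ≥ 1` and `ε ∈ (0,1]`,
`μᴺ({ω : S(t̄(ω)) ≥ ε}) ≤ (2/ε)·exp(−2Nε²)`. -/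
theorem hoeffding_bound_tbar {X : Type*} [MeasurableSpace X] (μ : Measure X)
    [IsProbabilityMeasure μ] (O : ℕ → Set X)
    (hOmeas : ∀ k : ℕ, MeasurableSet (O k)) (hOanti : ∀ k : ℕ, O (k + 1) ⊆ O k)
    (hO0 : O 0 = Set.univ)
    (N : ℕ) (hN : 1 ≤ N) (ε : ℝ) (hε0 : 0 < ε) (hε1 : ε ≤ 1) :
    (Measure.pi fun _ : Fin N => μ)
        {ω : Fin N → X | ENNReal.ofReal ε ≤ μ (O (tbar O ω) \ O (tbar O ω + 1))} ≤
      ENNReal.ofReal ((2 / ε) * Real.exp (-2 * N * ε ^ 2)) := by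
  set D : ℕ → Set X := fun k => O k \ O (k + 1) with hD
  have hDm : ∀ k, MeasurableSet (D k) := fun k => (hOmeas k).diff (hOmeas (k + 1))
  have hdisj : Pairwise (Function.onFun Disjoint D) := pairwise_disjoint_diff_succ hOanti
  have hfin : {k | ENNReal.ofReal ε ≤ μ (D k)}.Finite :=
    Measure.finite_const_le_meas_of_disjoint_iUnion μ (ENNReal.ofReal_pos.2 hε0) hDm hdisj
      (measure_ne_top μ _)
  set T := hfin.toFinset with hT
  have hTmem : ∀ k ∈ T, ε ≤ μ.real (D k) := fun k hk =>
    (ENNReal.ofReal_le_iff_le_toReal (measure_ne_top μ _)).1 (by simpa [hT] using hk)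
  have hTcard : (T.card : ℝ) ≤ 1 / ε := by
    rw [le_div_iff₀ hε0, ← nsmul_eq_mul]
    calc T.card • ε ≤ ∑ k ∈ T, μ.real (D k) := Finset.card_nsmul_le_sum _ _ _ hTmem
      _ = μ.real (⋃ k ∈ T, D k) :=
        (measureReal_biUnion_finset (fun j _ k _ h => hdisj h) fun k _ => hDm k).symm
      _ ≤ 1 := measureReal_le_one
  have hsub : {ω : Fin N → X | ENNReal.ofReal ε ≤ μ (O (tbar O ω) \ O (tbar O ω + 1))} ⊆
      ⋃ k ∈ T, Set.univ.pi fun _ : Fin N => (D k)ᶜ := fun ω hω =>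
    Set.mem_biUnion (x := tbar O ω) (by simpa [hT] using hω) fun i _ =>
      notMem_diff_of_empFrac_eq (hOanti _) hN (empFrac_tbar_eq hOanti hN ω) i
  have hpi : ∀ k ∈ T, (Measure.pi fun _ : Fin N => μ) (Set.univ.pi fun _ => (D k)ᶜ) ≤
      ENNReal.ofReal (Real.exp (-2 * N * ε ^ 2)) := fun k hk => by
    rw [Measure.pi_pi, Finset.prod_const, Finset.card_univ, Fintype.card_fin,
      ← ofReal_measureReal, ← ENNReal.ofReal_pow measureReal_nonneg,
      probReal_compl_eq_one_sub (hDm k)]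
    refine ENNReal.ofReal_le_ofReal ?_
    calc (1 - μ.real (D k)) ^ N ≤ (Real.exp (-2 * ε ^ 2)) ^ N :=
          pow_le_pow_left₀ (sub_nonneg.2 measureReal_le_one)
            ((sub_le_sub_left (hTmem k hk) 1).trans (one_sub_le_exp_neg_two_mul_sq hε0.le)) N
      _ = Real.exp (-2 * N * ε ^ 2) := by rw [← Real.exp_nat_mul]; ring_nf
  calc (Measure.pi fun _ : Fin N => μ)
        {ω : Fin N → X | ENNReal.ofReal ε ≤ μ (O (tbar O ω) \ O (tbar O ω + 1))}
      ≤ ∑ k ∈ T, (Measure.pi fun _ : Fin N => μ) (Set.univ.pi fun _ => (D k)ᶜ) :=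
        (measure_mono hsub).trans (measure_biUnion_finset_le _ _)
    _ ≤ T.card • ENNReal.ofReal (Real.exp (-2 * N * ε ^ 2)) := Finset.sum_le_card_nsmul _ _ _ hpi
    _ = ENNReal.ofReal (T.card * Real.exp (-2 * N * ε ^ 2)) := by
        rw [← ENNReal.ofReal_nsmul, nsmul_eq_mul]
    _ ≤ ENNReal.ofReal ((2 / ε) * Real.exp (-2 * N * ε ^ 2)) := by
        refine ENNReal.ofReal_le_ofReal (mul_le_mul_of_nonneg_right ?_ (Real.exp_pos _).le)
        exact hTcard.trans (by gcongr; norm_num)
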